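/- There exist path connected, aspherical, separable metric spaces X ⊂ Y such that the inclusion j : X ↪ Y induces an isomorphism on all homotopy groups, yet the topological fundamental groups π₁(X,p) and π₁(Y,p) are not homeomorphic; in particular X and Y do not have the same homotopy type, so the conclusion of the Whitehead theorem fails for (X,Y,j). -/

import Mathlib

open unitInterval Topology

noncomputable section

/-- The topological fundamental group: path components of the based loop space
(compact-open topology), with the quotient topology. -/
def piTop (Z : Type*) [TopologicalSpace Z] (z : Z) : Type _ :=
  Quotient (pathSetoid (Path z z))

instance (Z : Type*) [TopologicalSpace Z] (z : Z) : TopologicalSpace (piTop Z z) :=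
  instTopologicalSpaceQuotient

/-- The class of a loop in the topological fundamental group. -/
def piMk {Z : Type*} [TopologicalSpace Z] {z : Z} (γ : Path z z) : piTop Z z :=
  Quotient.mk _ γ

/-- Postcomposition with a continuous map is continuous on path spaces. -/
lemma continuous_pathMap {A B : Type*} [TopologicalSpace A] [TopologicalSpace B]
    {f : A → B} (hf : Continuous f) {x y : A} :
    Continuous fun γ : Path x y => γ.map hf := by
  rw [← Path.continuous_uncurry_iff]
  exact hf.comp continuous_eval

/-- The map `π₁(A,a) → π₁(B, f a)` induced by a continuous map `f`. -/
def piMap {A B : Type*} [TopologicalSpace A] [TopologicalSpace B] {f : A → B}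
    (hf : Continuous f) (a : A) : piTop A a → piTop B (f a) :=
  Quotient.map (fun γ => γ.map hf) fun _ _ h =>
    ⟨h.somePath.map (continuous_pathMap hf)⟩

namespace WH

/-- letters of the free group on `ℕ` -/
abbrev Lt := ℕ × Bool

def bar (x : Lt) : Lt := (x.1, !x.2)

@[simp] lemma bar_bar (x : Lt) : bar (bar x) = x := by simp [bar]

/-- reduced words; the head is the most recent letter -/
def Red : List Lt → Prop
  | [] => True
  | x :: v => v.head? ≠ some (bar x) ∧ Red v

/-- points of the universal covering tree -/
structure E where
  w : List Lt
  s : ℝ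
  red : Red w
  pos : 0 < s
  le : s ≤ 1
  root : w = [] → s = 1

def phi (w : List Lt) (s : ℝ) (v : List Lt) : ℝ :=
  if v = w then s else if v <:+ w then 1 else 0

lemma phi_self (w : List Lt) (s : ℝ) : phi w s w = s := by simp [phi]

lemma phi_zero (x : Lt) (v : List Lt) : phi (x :: v) 0 = phi v 1 := by
  funext u
  unfold phi
  simp only [List.suffix_cons_iff]
  by_cases h1 : u = x :: v
  · subst h1
    have : ¬ (x :: v) <:+ v := fun h => by have := h.length_le; simp at this
    simp [this]
  · by_cases h2 : u = v
    · subst h2; simp [h1]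
    · simp [h1, h2]

lemma phi_bound (w : List Lt) {s : ℝ} (h0 : 0 ≤ s) (h1 : s ≤ 1) (v : List Lt) :
    0 ≤ phi w s v ∧ phi w s v ≤ 1 := by
  unfold phi; split_ifs <;> constructor <;> linarith

def Phi (e : E) : lp (fun _ : List Lt => ℝ) ⊤ :=
  ⟨phi e.w e.s, memℓp_infty ⟨1, by
    rintro _ ⟨v, rfl⟩
    have := phi_bound e.w e.pos.le e.le v
    simp only [Real.norm_eq_abs]
    rw [abs_le]; constructor <;> linarith⟩⟩

instance : PseudoMetricSpace E := PseudoMetricSpace.induced Phi inferInstance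

lemma le_dist (e e' : E) (v : List Lt) : |phi e.w e.s v - phi e'.w e'.s v| ≤ dist e e' := by
  change _ ≤ dist (Phi e) (Phi e')
  rw [dist_eq_norm]
  exact lp.norm_apply_le_norm (by simp) (Phi e - Phi e') v

lemma dist_le {e e' : E} {C : ℝ} (hC : 0 ≤ C)
    (h : ∀ v, |phi e.w e.s v - phi e'.w e'.s v| ≤ C) : dist e e' ≤ C := by
  change dist (Phi e) (Phi e') ≤ C
  rw [dist_eq_norm]
  exact lp.norm_le_of_forall_le hC h

lemma near_edge {e e' : E} (h1 : dist e e' < e.s) (h2 : dist e e' < 1 - e.s) :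
    e'.w = e.w ∧ |e.s - e'.s| ≤ dist e e' := by
  have h := le_dist e e' e.w
  rw [phi_self] at h
  by_cases hw : e'.w = e.w
  · rw [hw, phi_self] at h; exact ⟨hw, h⟩
  · exfalso
    unfold phi at h
    rw [if_neg (Ne.symm hw)] at h
    split_ifs at h
    · have := abs_le.1 h; linarith [this.1]
    · have := abs_le.1 h; linarith [this.2]

lemma near_vertex {e e' : E} (h0 : e.s = 1) (h1 : dist e e' < 1) :
    (e'.w = e.w ∧ 1 - e'.s ≤ dist e e') ∨ (∃ y, e'.w = y :: e.w ∧ e'.s ≤ dist e e') := by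
  have h := le_dist e e' e.w
  rw [phi_self, h0] at h
  by_cases hw : e'.w = e.w
  · rw [hw, phi_self] at h; exact Or.inl ⟨hw, (le_abs_self _).trans h⟩
  right
  have hs : e.w <:+ e'.w := by
    by_contra hs
    unfold phi at h
    rw [if_neg (Ne.symm hw), if_neg hs] at h
    norm_num at h; linarith
  obtain ⟨t, ht⟩ := hs
  rcases List.eq_nil_or_concat t with rfl | ⟨l, y, rfl⟩
  · exact absurd ht.symm hw
  have ht' : l ++ (y :: e.w) = e'.w := by simpa using ht
  have h' := le_dist e e' (y :: e.w)
  have hn : ¬ (y :: e.w) <:+ e.w := fun h => by have := h.length_le; simp at this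
  have h3 : phi e.w e.s (y :: e.w) = 0 := by simp [phi, hn]
  rw [h3] at h'
  by_cases hl : y :: e.w = e'.w
  · refine ⟨y, hl.symm, ?_⟩
    rw [← hl, phi_self] at h'
    have := abs_le.1 h'; linarith [this.1]
  · exfalso
    unfold phi at h'
    rw [if_neg hl, if_pos ⟨l, ht'⟩] at h'
    norm_num at h'; linarith

lemma E.ext' {e e' : E} (h : e.w = e'.w) (h' : e.s = e'.s) : e = e' := by
  cases e; cases e'; simp_all

lemma eq_of_dist {e e' : E} (h : dist e e' = 0) : e = e' := by
  rcases e.le.lt_or_eq with h1 | h1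
  · obtain ⟨hw, hs⟩ := near_edge (e := e) (e' := e') (by rw [h]; exact e.pos) (by rw [h]; linarith)
    rw [h] at hs
    exact E.ext' hw.symm (by linarith [abs_nonpos_iff.1 hs])
  · rcases near_vertex h1 (by rw [h]; norm_num) with ⟨hw, hs⟩ | ⟨y, hw, hs⟩
    · exact E.ext' hw.symm (by linarith [e'.le])
    · linarith [e'.pos]

lemma eq_of_phi {e e' : E} (h : ∀ v, phi e.w e.s v = phi e'.w e'.s v) : e = e' :=
  eq_of_dist (le_antisymm (dist_le le_rfl fun v => by simp [h v]) dist_nonneg)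

def vert (w : List Lt) (h : Red w) : E := ⟨w, 1, h, one_pos, le_rfl, fun _ => rfl⟩

def rt : E := vert [] trivial

def depth (e : E) : ℝ := e.w.length - 1 + e.s

lemma depth_nonneg (e : E) : 0 ≤ depth e := by
  unfold depth
  rcases h : e.w with _ | ⟨x, v⟩
  · simp [e.root h]
  · have := e.pos; simp; positivity

lemma continuous_depth : Continuous depth := by
  rw [Metric.continuous_iff']
  intro e ε hε
  rcases e.le.lt_or_eq with h1 | h1
  · have hp : 0 < min ε (min e.s (1 - e.s)) := lt_min hε (lt_min e.pos (by linarith))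
    filter_upwards [Metric.ball_mem_nhds e hp] with e' he'
    rw [Metric.mem_ball, dist_comm, lt_min_iff, lt_min_iff] at he'
    obtain ⟨hw, hs⟩ := near_edge he'.2.1 he'.2.2
    rw [dist_comm, Real.dist_eq]
    unfold depth
    rw [hw]
    calc _ = |e.s - e'.s| := by ring_nf
      _ < ε := by linarith
  · have hp : 0 < min ε 1 := lt_min hε one_pos
    filter_upwards [Metric.ball_mem_nhds e hp] with e' he'
    rw [Metric.mem_ball, dist_comm, lt_min_iff] at he'
    rw [Real.dist_eq]
    unfold depth
    have := e'.le
    have := e'.pos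
    rcases near_vertex h1 he'.2 with ⟨hw, hs⟩ | ⟨y, hw, hs⟩
    · rw [hw, abs_lt]; constructor <;> linarith
    · rw [hw, abs_lt]; push_cast [List.length_cons]; constructor <;> linarith

def tr (τ : ℝ) (f : List Lt → ℝ) (v : List Lt) : ℝ := min (f v) (max 0 (τ - v.length + 1))

lemma exists_trunc (w : List Lt) : ∀ (s : ℝ) (hr : Red w) (h0 : 0 < s) (h1 : s ≤ 1)
    (hroot : w = [] → s = 1) (τ : ℝ) (hτ : 0 ≤ τ),
    ∃ e : E, ∀ v, phi e.w e.s v = tr τ (phi w s) v := by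
  induction w with
  | nil =>
    intro s hr h0 h1 hroot τ hτ
    refine ⟨rt, fun v => ?_⟩
    have := hroot rfl
    subst this
    unfold rt vert tr phi
    by_cases hv : v = []
    · subst hv; simp; right; linarith
    · simp [hv]
  | cons x w ih =>
    intro s hr h0 h1 hroot τ hτ
    by_cases hcase : τ ≤ w.length
    · obtain ⟨e, he⟩ := ih 1 hr.2 one_pos le_rfl (fun _ => rfl) τ hτ
      refine ⟨e, fun v => ?_⟩
      rw [he]
      unfold tr
      by_cases hv : v = x :: w
      · subst hv
        have : max 0 (τ - ((x :: w).length : ℝ) + 1) = 0 := by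
          apply max_eq_left; push_cast [List.length_cons]; linarith
        rw [this, phi_self, min_eq_right h0.le, min_eq_right]
        exact (phi_bound _ zero_le_one le_rfl _).1
      · have : phi (x :: w) s v = phi (x :: w) 0 v := by simp [phi, hv]
        rw [this, phi_zero]
    · push Not at hcase
      refine ⟨⟨x :: w, min s (τ - w.length), hr, lt_min h0 (by linarith),
        (min_le_left _ _).trans h1, by simp⟩, fun v => ?_⟩
      unfold tr
      by_cases hv : v = x :: w
      · subst hv
        simp only [phi_self]
        congr 1
        rw [max_eq_right] <;> push_cast [List.length_cons] <;> linarith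
      · simp only [phi, hv, if_false]
        split_ifs with h
        · have hl : v.length ≤ w.length := by
            rcases List.suffix_cons_iff.1 h with h | h
            · exact absurd h hv
            · exact h.length_le
          have : (v.length : ℝ) ≤ w.length := by exact_mod_cast hl
          rw [min_eq_left]
          exact le_max_of_le_right (by linarith)
        · simp

def trunc (e : E) (τ : ℝ) : E :=
  (exists_trunc e.w e.s e.red e.pos e.le e.root (max τ 0) (le_max_right _ _)).choose

lemma phi_trunc (e : E) (τ : ℝ) (v : List Lt) :
    phi (trunc e τ).w (trunc e τ).s v = tr (max τ 0) (phi e.w e.s) v :=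
  (exists_trunc e.w e.s e.red e.pos e.le e.root (max τ 0) (le_max_right _ _)).choose_spec v

lemma dist_trunc (e e' : E) (τ τ' : ℝ) :
    dist (trunc e τ) (trunc e' τ') ≤ max (dist e e') (dist τ τ') := by
  refine dist_le (le_max_of_le_left dist_nonneg) fun v => ?_
  rw [phi_trunc, phi_trunc]
  unfold tr
  refine (abs_min_sub_min_le_max _ _ _ _).trans (max_le_max (le_dist _ _ _) ?_)
  refine (abs_max_sub_max_le_max _ _ _ _).trans ?_
  rw [sub_self, abs_zero, max_eq_right (abs_nonneg _)]
  calc _ = |max τ 0 - max τ' 0| := by ring_nf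
    _ ≤ max |τ - τ'| |0 - 0| := abs_max_sub_max_le_max _ _ _ _
    _ = dist τ τ' := by rw [sub_self, abs_zero, max_eq_left (abs_nonneg _), Real.dist_eq]

lemma continuous_trunc : Continuous fun q : E × ℝ => trunc q.1 q.2 := by
  have : LipschitzWith 1 fun q : E × ℝ => trunc q.1 q.2 := by
    refine LipschitzWith.of_dist_le_mul fun q q' => ?_
    simpa [Prod.dist_eq] using dist_trunc q.1 q'.1 q.2 q'.2
  exact this.continuous

lemma trunc_depth (e : E) : trunc e (depth e) = e := by
  apply eq_of_phi
  intro v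
  rw [phi_trunc, max_eq_left (depth_nonneg e)]
  unfold tr
  apply min_eq_left
  have hb := phi_bound e.w e.pos.le e.le v
  by_cases hv : v = e.w
  · subst hv
    rw [phi_self]
    apply le_max_of_le_right
    unfold depth; linarith
  · simp only [phi, hv, if_false]
    split_ifs with h
    · apply le_max_of_le_right
      have : v.length + 1 ≤ e.w.length :=
        lt_of_le_of_ne h.length_le fun hl => hv (h.eq_of_length hl)
      have : (v.length : ℝ) + 1 ≤ e.w.length := by exact_mod_cast this
      unfold depth; linarith [e.pos]
    · exact le_max_left _ _

lemma trunc_zero (e : E) : trunc e 0 = rt := by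
  apply eq_of_phi
  intro v
  rw [phi_trunc]
  unfold tr rt vert
  rcases v with _ | ⟨x, v⟩
  · have : phi e.w e.s [] = 1 := by
      unfold phi
      split_ifs with h h'
      · exact e.root h.symm
      · rfl
      · exact absurd List.nil_suffix h'
    rw [this]; simp [phi]
  · have hb := phi_bound e.w e.pos.le e.le (x :: v)
    have : max 0 (max (0:ℝ) 0 - ((x :: v).length : ℝ) + 1) = 0 := by
      apply max_eq_left; push_cast [List.length_cons]; simp
    rw [this, min_eq_right hb.1]
    simp [phi]

/-- strong deformation contraction of the tree to its root -/
def contr : C(I × E, E) :=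
  ⟨fun q => trunc q.2 ((1 - (q.1 : ℝ)) * depth q.2),
    continuous_trunc.comp (continuous_snd.prodMk
      ((continuous_const.sub (continuous_subtype_val.comp continuous_fst)).mul
        (continuous_depth.comp continuous_snd)))⟩

lemma contr_zero (e : E) : contr (0, e) = e := by
  simp [contr, trunc_depth]

lemma contr_one (e : E) : contr (1, e) = rt := by
  simp [contr, trunc_zero]

lemma contr_rt (t : I) : contr (t, rt) = rt := by
  have : depth rt = 0 := by simp [depth, rt, vert]
  simp [contr, this, trunc_zero]

end WH

namespace WH

def tent (a : ℝ) : ℝ := min a (1 - a)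

lemma continuous_tent : Continuous tent := by unfold tent; fun_prop

lemma tent_symm (a : ℝ) : tent (1 - a) = tent a := by
  unfold tent; rw [min_comm]; simp

lemma tent_nonneg {a : ℝ} (h0 : 0 ≤ a) (h1 : a ≤ 1) : 0 ≤ tent a := le_min h0 (by linarith)

lemma tent_pos {a : ℝ} (h0 : 0 < a) (h1 : a < 1) : 0 < tent a := lt_min h0 (by linarith)

/-- the `n`-th loop -/
def cc (n : ℕ) (a : ℝ) : ℝ × ℝ := (tent a / (n + 1 + a), tent a)

def Xs : Set (ℝ × ℝ) := {q | ∃ (n : ℕ) (a : ℝ), 0 ≤ a ∧ a ≤ 1 ∧ q = cc n a}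

lemma cc_zero (n : ℕ) : cc n 0 = (0, 0) := by simp [cc, tent]
lemma cc_one (n : ℕ) : cc n 1 = (0, 0) := by simp [cc, tent]

lemma hp : ((0, 0) : ℝ × ℝ) ∈ Xs := ⟨0, 0, le_rfl, zero_le_one, (cc_zero 0).symm⟩

abbrev pX : Xs := ⟨(0, 0), hp⟩

def NN (q : ℝ × ℝ) : ℕ := ⌊q.2 / q.1⌋₊ - 1
def AA (q : ℝ × ℝ) : ℝ := q.2 / q.1 - NN q - 1

lemma cc_slope (n : ℕ) {a : ℝ} (h0 : 0 < a) (h1 : a < 1) :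
    (cc n a).2 / (cc n a).1 = n + 1 + a := by
  have := tent_pos h0 h1
  have : (0:ℝ) < n + 1 + a := by positivity
  unfold cc
  field_simp

lemma NN_cc (n : ℕ) {a : ℝ} (h0 : 0 < a) (h1 : a < 1) : NN (cc n a) = n := by
  unfold NN
  rw [cc_slope n h0 h1]
  have : ⌊(n : ℝ) + 1 + a⌋₊ = n + 1 := by
    rw [Nat.floor_eq_iff (by positivity)]; push_cast; constructor <;> linarith
  rw [this]; simp

lemma AA_cc (n : ℕ) {a : ℝ} (h0 : 0 < a) (h1 : a < 1) : AA (cc n a) = a := by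
  unfold AA
  rw [NN_cc n h0 h1, cc_slope n h0 h1]; ring

/-- normal form of a point of X -/
lemma Xs_cases (x : Xs) : x = pX ∨ ∃ (n : ℕ) (a : ℝ), 0 < a ∧ a < 1 ∧ x.1 = cc n a := by
  obtain ⟨q, n, a, h0, h1, rfl⟩ := x
  rcases h0.eq_or_lt with rfl | h0
  · left; ext1; exact cc_zero n
  rcases h1.eq_or_lt with rfl | h1
  · left; ext1; exact cc_one n
  right; exact ⟨n, a, h0, h1, rfl⟩

lemma norm_Xs (x : Xs) : dist x pX = x.1.2 := by
  obtain ⟨q, n, a, h0, h1, rfl⟩ := x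
  rw [Subtype.dist_eq, Prod.dist_eq]
  have h := tent_nonneg h0 h1
  have h3 : (1:ℝ) ≤ n + 1 + a := by have : (0:ℝ) ≤ n := n.cast_nonneg; linarith
  have h2 : tent a / (n + 1 + a) ≤ tent a := div_le_self h h3
  have h4 : 0 ≤ tent a / (n + 1 + a) := by positivity
  simp only [cc, Real.dist_eq, sub_zero]
  rw [abs_of_nonneg h, abs_of_nonneg h4, max_eq_right h2]

lemma slope_continuousAt {x : Xs} {n : ℕ} {a : ℝ} (h0 : 0 < a) (h1 : a < 1) (hx : x.1 = cc n a) :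
    ContinuousAt (fun x : Xs => x.1.2 / x.1.1) x := by
  apply ContinuousAt.div
  · exact (continuous_snd.comp continuous_subtype_val).continuousAt
  · exact (continuous_fst.comp continuous_subtype_val).continuousAt
  · rw [hx]
    have := tent_pos h0 h1
    have : (0:ℝ) < n + 1 + a := by positivity
    simp only [cc]; positivity

lemma NN_eventually {x : Xs} {n : ℕ} {a : ℝ} (h0 : 0 < a) (h1 : a < 1) (hx : x.1 = cc n a) :
    ∀ᶠ x' : Xs in 𝓝 x, x'.1.2 ≠ 0 ∧ NN x'.1 = n := by
  have hs : x.1.2 / x.1.1 = n + 1 + a := by rw [hx, cc_slope n h0 h1]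
  have h := (slope_continuousAt h0 h1 hx).eventually
    (Ioo_mem_nhds (a := (n:ℝ) + 1) (b := n + 2) (by simp only [hs]; linarith)
      (by simp only [hs]; linarith))
  filter_upwards [h] with x' hx'
  have hn : (0:ℝ) ≤ n := n.cast_nonneg
  refine ⟨fun h => ?_, ?_⟩
  · rw [h, zero_div] at hx'; have := hx'.1; linarith
  · unfold NN
    have : ⌊x'.1.2 / x'.1.1⌋₊ = n + 1 := by
      rw [Nat.floor_eq_iff (by linarith [hx'.1])]; push_cast
      constructor <;> linarith [hx'.1, hx'.2]
    rw [this]; simp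

lemma AA_continuousAt {x : Xs} {n : ℕ} {a : ℝ} (h0 : 0 < a) (h1 : a < 1) (hx : x.1 = cc n a) :
    ContinuousAt (fun x : Xs => AA x.1) x := by
  have h : ContinuousAt (fun x : Xs => x.1.2 / x.1.1 - n - 1) x :=
    ((slope_continuousAt h0 h1 hx).sub continuousAt_const).sub continuousAt_const
  refine h.congr ?_
  filter_upwards [NN_eventually h0 h1 hx] with x' hx'
  simp [AA, hx'.2]

/-- arc position from travel fraction -/
def arc (b : Bool) (s : ℝ) : ℝ := if b then s else 1 - s

lemma tent_arc (b : Bool) (s : ℝ) : tent (arc b s) = tent s := by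
  unfold arc; split_ifs <;> simp [tent_symm]

/-- position of the point on X, given word and travel fraction -/
def pr (w : List Lt) (s : ℝ) : ℝ × ℝ :=
  match w with
  | [] => (0, 0)
  | x :: _ => cc x.1 (arc x.2 s)

lemma arc_mem {b : Bool} {s : ℝ} (h0 : 0 ≤ s) (h1 : s ≤ 1) : 0 ≤ arc b s ∧ arc b s ≤ 1 := by
  unfold arc; split_ifs <;> constructor <;> linarith

lemma arc_mem' {b : Bool} {s : ℝ} (h0 : 0 < s) (h1 : s < 1) : 0 < arc b s ∧ arc b s < 1 := by
  unfold arc; split_ifs <;> constructor <;> linarith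

lemma pr_mem (w : List Lt) {s : ℝ} (h0 : 0 ≤ s) (h1 : s ≤ 1) : pr w s ∈ Xs := by
  rcases w with _ | ⟨x, v⟩
  · exact hp
  · exact ⟨x.1, _, (arc_mem h0 h1).1, (arc_mem h0 h1).2, rfl⟩

def proj (e : E) : Xs := ⟨pr e.w e.s, pr_mem _ e.pos.le e.le⟩

lemma proj_snd (e : E) : (proj e).1.2 = tent e.s := by
  change (pr e.w e.s).2 = tent e.s
  unfold pr
  rcases h : e.w with _ | ⟨x, v⟩
  · simp [e.root h, tent]
  · simp [cc, tent_arc]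

lemma continuous_cc (n : ℕ) {a : ℝ} (h0 : 0 ≤ a) : ContinuousAt (cc n) a := by
  unfold cc
  have : (n:ℝ) + 1 + a ≠ 0 := by positivity
  exact (continuous_tent.continuousAt.div (by fun_prop) this).prodMk continuous_tent.continuousAt

lemma continuous_arc (b : Bool) : Continuous (arc b) := by
  unfold arc; split_ifs <;> fun_prop

lemma eventually_edge {e : E} (h1 : e.s < 1) :
    ∀ᶠ e' in 𝓝 e, e'.w = e.w ∧ |e.s - e'.s| ≤ dist e e' := by
  have hp : 0 < min e.s (1 - e.s) := lt_min e.pos (by linarith)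
  filter_upwards [Metric.ball_mem_nhds e hp] with e' he'
  rw [Metric.mem_ball, dist_comm, lt_min_iff] at he'
  exact near_edge he'.1 he'.2

lemma continuousAt_s {e : E} (h1 : e.s < 1) : ContinuousAt E.s e := by
  rw [Metric.continuousAt_iff']
  intro ε hε
  filter_upwards [eventually_edge h1, Metric.ball_mem_nhds e hε] with e' he' hb
  rw [Metric.mem_ball, dist_comm] at hb
  rw [dist_comm, Real.dist_eq]; linarith

lemma continuous_proj : Continuous proj := by
  rw [continuous_iff_continuousAt]
  intro e
  rcases e.le.lt_or_eq with h1 | h1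
  · rw [Topology.IsEmbedding.subtypeVal.continuousAt_iff]
    rcases h : e.w with _ | ⟨x, v⟩
    · linarith [e.root h]
    have h3 : ContinuousAt (fun e : E => cc x.1 (arc x.2 e.s)) e := by
      have h4 : ContinuousAt (fun e : E => arc x.2 e.s) e :=
        (continuous_arc x.2).continuousAt.comp (continuousAt_s h1)
      exact ContinuousAt.comp (f := fun e : E => arc x.2 e.s) (g := cc x.1)
        (continuous_cc x.1 (arc_mem e.pos.le h1.le).1) h4
    refine h3.congr ?_
    filter_upwards [eventually_edge h1] with e' he'
    simp [proj, pr, he'.1, h]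
  · have hp : proj e = pX := by
      have h := norm_Xs (proj e)
      rw [proj_snd, h1] at h
      exact dist_eq_zero.1 (by simpa [tent] using h)
    rw [Metric.continuousAt_iff']
    intro ε hε
    have hp' : 0 < min ε 1 := lt_min hε one_pos
    filter_upwards [Metric.ball_mem_nhds e hp'] with e' he'
    rw [Metric.mem_ball, dist_comm, lt_min_iff] at he'
    rw [hp, norm_Xs, proj_snd]
    unfold tent
    rcases near_vertex h1 he'.2 with ⟨hw, hs⟩ | ⟨y, hw, hs⟩
    · exact (min_le_right _ _).trans_lt (by linarith)
    · exact (min_le_left _ _).trans_lt (by linarith)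

/-- the fibre: reduced words, with discrete topology -/
def Wd : Type := {w : List Lt // Red w}
instance : TopologicalSpace Wd := ⊥
instance : DiscreteTopology Wd := ⟨rfl⟩

lemma Red.tail {x : Lt} {v : List Lt} (h : Red (x :: v)) : Red v := h.2

/-- vertex component -/
def cmp (κ : ℝ) (w : List Lt) (s : ℝ) : List Lt :=
  match w with
  | [] => []
  | x :: v => if x.2 then (if s < κ then v else x :: v) else (if 1 - s < κ then x :: v else v)

lemma cmp_red (κ : ℝ) {w : List Lt} (s : ℝ) (h : Red w) : Red (cmp κ w s) := by
  rcases w with _ | ⟨x, v⟩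
  · trivial
  · unfold cmp; simp only; split_ifs <;> first | exact h | exact h.2

def cmpE (κ : ℝ) (e : E) : Wd := ⟨cmp κ e.w e.s, cmp_red κ e.s e.red⟩

/-- move from vertex `v` along letter `x` by `a` -/
def move (v : Wd) (x : Lt) (a : ℝ) : E :=
  if h : 0 < a ∧ a < 1 then
    if h' : v.1.head? = some (bar x) then
      ⟨v.1, 1 - a, v.2, by linarith [h.2], by linarith [h.1], fun h => by simp [h] at h'⟩
    else ⟨x :: v.1, a, ⟨h', v.2⟩, h.1, h.2.le, by simp⟩
  else vert v.1 v.2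

lemma phi_move (v : Wd) (x : Lt) {a : ℝ} (h0 : 0 ≤ a) (h1 : a < 1) :
    phi (move v x a).w (move v x a).s =
      if v.1.head? = some (bar x) then phi v.1 (1 - a) else phi (x :: v.1) a := by
  rcases h0.eq_or_lt with rfl | h0
  · simp [move, vert, phi_zero]
  · unfold move
    rw [dif_pos ⟨h0, h1⟩]
    split_ifs <;> rfl

lemma move_zero (v : Wd) (x : Lt) : move v x 0 = vert v.1 v.2 := by simp [move]

lemma phi_lip (w : List Lt) (s s' : ℝ) (v : List Lt) : |phi w s v - phi w s' v| ≤ |s - s'| := by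
  unfold phi; split_ifs <;> simp

lemma dist_move (v : Wd) (x : Lt) {a a' : ℝ} (h0 : 0 ≤ a) (h1 : a < 1) (h0' : 0 ≤ a')
    (h1' : a' < 1) : dist (move v x a) (move v x a') ≤ |a - a'| := by
  refine dist_le (abs_nonneg _) fun u => ?_
  rw [phi_move v x h0 h1, phi_move v x h0' h1']
  split_ifs
  · refine (phi_lip _ _ _ _).trans ?_
    rw [abs_sub_comm]; apply le_of_eq; ring_nf
  · exact phi_lip _ _ _ _

/-- local sections -/
def sec (κ : ℝ) (v : Wd) (q : ℝ × ℝ) : E :=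
  if q.2 = 0 then vert v.1 v.2
  else if AA q < κ then move v (NN q, true) (AA q)
  else move v (NN q, false) (1 - AA q)

lemma snd_cc (n : ℕ) (a : ℝ) : (cc n a).2 = tent a := rfl

lemma sec_cc (κ : ℝ) (v : Wd) (n : ℕ) {a : ℝ} (h0 : 0 < a) (h1 : a < 1) :
    sec κ v (cc n a) = if a < κ then move v (n, true) a else move v (n, false) (1 - a) := by
  unfold sec
  rw [AA_cc n h0 h1, NN_cc n h0 h1, if_neg]
  rw [snd_cc]; exact (tent_pos h0 h1).ne'

lemma move_continuousAt (v : Wd) (x : Lt) {a : ℝ} (h0 : 0 < a) (h1 : a < 1) :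
    ContinuousAt (move v x) a := by
  rw [Metric.continuousAt_iff']
  intro ε hε
  filter_upwards [Ioo_mem_nhds h0 h1, Metric.ball_mem_nhds a hε] with a' ha' hb
  exact (dist_move v x ha'.1.le ha'.2 h0.le h1).trans_lt hb

lemma sec_continuousAt {κ : ℝ} (hκ : κ = 0 ∨ κ = 1 / 2) (v : Wd) (x : Xs) (hx : x.1.2 ≠ κ) :
    ContinuousAt (fun x : Xs => sec κ v x.1) x := by
  rcases Xs_cases x with rfl | ⟨n, a, h0, h1, hxa⟩
  · have hκ : κ = 1 / 2 := by
      rcases hκ with rfl | h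
      · simp at hx
      · exact h
    subst hκ
    rw [Metric.continuousAt_iff']
    intro ε hε
    filter_upwards [Metric.ball_mem_nhds pX hε] with x' hx'
    rw [Metric.mem_ball, norm_Xs] at hx'
    have hv : sec (1 / 2) v (pX : Xs).1 = vert v.1 v.2 := by simp [sec]
    rw [hv]
    rcases Xs_cases x' with rfl | ⟨n, a, h0, h1, hxa⟩
    · rw [hv]; simpa using hε
    · rw [hxa, sec_cc _ _ _ h0 h1]
      rw [hxa, snd_cc] at hx'
      unfold tent at hx'
      split_ifs with h
      · rw [← move_zero v (n, true)]
        refine (dist_move _ _ h0.le h1 le_rfl one_pos).trans_lt ?_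
        rw [min_eq_left (by linarith)] at hx'
        rwa [sub_zero, abs_of_pos h0]
      · rw [← move_zero v (n, false)]
        refine (dist_move _ _ (by linarith) (by linarith) le_rfl one_pos).trans_lt ?_
        rw [min_eq_right (by linarith)] at hx'
        rwa [sub_zero, abs_of_pos (by linarith)]
  · have hA := AA_continuousAt h0 h1 hxa
    have hAx : AA x.1 = a := by rw [hxa, AA_cc n h0 h1]
    have hne : a ≠ κ := by
      rintro rfl
      apply hx; rw [hxa, snd_cc]
      rcases hκ with rfl | rfl
      · simp [tent]
      · norm_num [tent]
    have hN := NN_eventually h0 h1 hxa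
    rcases lt_or_gt_of_ne hne with hlt | hgt
    · have h3 : ContinuousAt (fun x : Xs => move v (n, true) (AA x.1)) x :=
        ContinuousAt.comp (f := fun x : Xs => AA x.1) (g := move v (n, true))
          (by rw [hAx]; exact move_continuousAt v _ h0 h1) hA
      refine h3.congr ?_
      filter_upwards [hN, hA.eventually (gt_mem_nhds (show AA x.1 < κ by rw [hAx]; exact hlt))] with x' hx' hl
      unfold sec
      rw [if_neg hx'.1, if_pos hl, hx'.2]
    · have h3 : ContinuousAt (fun x : Xs => move v (n, false) (1 - AA x.1)) x :=
        ContinuousAt.comp (f := fun x : Xs => 1 - AA x.1) (g := move v (n, false))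
          (by rw [hAx]; exact move_continuousAt v _ (by linarith) (by linarith))
          (continuousAt_const.sub hA)
      refine h3.congr ?_
      filter_upwards [hN, hA.eventually (lt_mem_nhds (show κ < AA x.1 by rw [hAx]; exact hgt))] with x' hx' hl
      unfold sec
      rw [if_neg hx'.1, if_neg (not_lt.2 hl.le), hx'.2]

lemma arc_arc (b : Bool) (s : ℝ) : arc b (arc b s) = s := by unfold arc; split_ifs <;> ring

lemma tent_zero_s {e : E} (h : tent e.s = 0) : e.s = 1 := by
  unfold tent at h
  have := e.pos; have := e.le
  rcases min_choice e.s (1 - e.s) with h' | h' <;> rw [h'] at h <;> linarith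

lemma move_pos {v : Wd} {x : Lt} {a : ℝ} {e : E} (h : v.1.head? = some (bar x)) (h0 : 0 < a)
    (h1 : a < 1) (hw : e.w = v.1) (hs : e.s = 1 - a) : move v x a = e := by
  unfold move
  rw [dif_pos ⟨h0, h1⟩, dif_pos h]
  exact E.ext' hw.symm hs.symm

lemma move_neg {v : Wd} {x : Lt} {a : ℝ} {e : E} (h : v.1.head? ≠ some (bar x)) (h0 : 0 < a)
    (h1 : a < 1) (hw : e.w = x :: v.1) (hs : e.s = a) : move v x a = e := by
  unfold move
  rw [dif_pos ⟨h0, h1⟩, dif_neg h]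
  exact E.ext' hw.symm hs.symm

lemma sec_proj {κ : ℝ} (hκ : κ = 0 ∨ κ = 1 / 2) (e : E) (he : (proj e).1.2 ≠ κ) :
    sec κ (cmpE κ e) (proj e).1 = e := by
  obtain ⟨w, s, hr, h0, h1, hroot⟩ := e
  rw [proj_snd] at he
  simp only at he
  rcases h1.lt_or_eq with h1' | rfl
  · rcases w with _ | ⟨⟨n, b⟩, v⟩
    · linarith [hroot rfl]
    have hpr : (proj ⟨(n, b) :: v, s, hr, h0, h1, hroot⟩).1 = cc n (arc b s) := rfl
    rw [hpr, sec_cc _ _ _ (arc_mem' h0 h1').1 (arc_mem' h0 h1').2]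
    have hvr := hr.1
    cases b
    · by_cases h : 1 - s < κ
      · have hc : cmpE κ ⟨(n, false) :: v, s, hr, h0, h1, hroot⟩ = ⟨(n, false) :: v, hr⟩ :=
          Subtype.ext (by simp [cmpE, cmp, h])
        rw [hc, if_pos (by simpa [arc] using h)]
        exact move_pos rfl (by simp [arc]; linarith) (by simp [arc]; linarith) rfl (by simp [arc])
      · have hc : cmpE κ ⟨(n, false) :: v, s, hr, h0, h1, hroot⟩ = ⟨v, hr.2⟩ :=
          Subtype.ext (by simp [cmpE, cmp, h])
        rw [hc, if_neg (by simpa [arc] using h)]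
        exact move_neg hvr (by simp [arc]; linarith) (by simp [arc]; linarith) rfl (by simp [arc])
    · by_cases h : s < κ
      · have hc : cmpE κ ⟨(n, true) :: v, s, hr, h0, h1, hroot⟩ = ⟨v, hr.2⟩ :=
          Subtype.ext (by simp [cmpE, cmp, h])
        rw [hc, if_pos (by simpa [arc] using h)]
        exact move_neg hvr (by simp [arc]; linarith) (by simp [arc]; linarith) rfl (by simp [arc])
      · have hc : cmpE κ ⟨(n, true) :: v, s, hr, h0, h1, hroot⟩ = ⟨(n, true) :: v, hr⟩ :=
          Subtype.ext (by simp [cmpE, cmp, h])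
        rw [hc, if_neg (by simpa [arc] using h)]
        exact move_pos rfl (by simp [arc]; linarith) (by simp [arc]; linarith) rfl (by simp [arc])
  · have hκ : κ = 1 / 2 := by
      rcases hκ with rfl | h
      · simp [tent] at he
      · exact h
    subst hκ
    unfold sec
    rw [proj_snd, if_pos (by simp [tent])]
    have : cmpE (1 / 2) ⟨w, 1, hr, h0, h1, hroot⟩ = ⟨w, hr⟩ := by
      apply Subtype.ext
      rcases w with _ | ⟨x, v⟩
      · rfl
      · simp only [cmpE, cmp]; norm_num
    rw [this]; rfl

lemma proj_vert (v : Wd) : proj (vert v.1 v.2) = pX := by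
  have h := norm_Xs (proj (vert v.1 v.2))
  rw [proj_snd] at h
  exact dist_eq_zero.1 (by simpa [tent, vert] using h)

lemma cons_of_head {v : List Lt} {x : Lt} (h : v.head? = some x) : ∃ u, v = x :: u := by
  rcases v with _ | ⟨y, u⟩
  · simp at h
  · simp at h; exact ⟨u, by rw [h]⟩

lemma proj_move (v : Wd) (n : ℕ) (b : Bool) {a : ℝ} (h0 : 0 < a) (h1 : a < 1) :
    (proj (move v (n, b) a)).1 = cc n (arc b a) := by
  unfold move
  rw [dif_pos ⟨h0, h1⟩]
  split_ifs with h
  · obtain ⟨u, hu⟩ := cons_of_head h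
    simp only [proj, hu, pr, bar, arc]
    cases b <;> simp
  · rfl

lemma proj_sec (κ : ℝ) (v : Wd) (x : Xs) : proj (sec κ v x.1) = x := by
  rcases Xs_cases x with rfl | ⟨n, a, h0, h1, hxa⟩
  · simp only [sec, if_true]; exact proj_vert v
  · apply Subtype.ext
    rw [hxa, sec_cc _ _ _ h0 h1]
    split_ifs with h
    · rw [proj_move v n true h0 h1]; rfl
    · rw [proj_move v n false (by linarith) (by linarith)]; simp [arc]

lemma cmp_sec {κ : ℝ} (hκ : κ = 0 ∨ κ = 1 / 2) (v : Wd) (x : Xs) (hx : x.1.2 ≠ κ) :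
    cmpE κ (sec κ v x.1) = v := by
  apply Subtype.ext
  rcases Xs_cases x with rfl | ⟨n, a, h0, h1, hxa⟩
  · have hκ : κ = 1 / 2 := by
      rcases hκ with rfl | h
      · simp at hx
      · exact h
    subst hκ
    obtain ⟨w, hw⟩ := v
    rcases w with _ | ⟨x, u⟩
    · simp [sec, vert, cmpE, cmp]
    · simp only [sec, vert, cmpE, cmp]; norm_num
  · have hne : a ≠ κ := by
      rintro rfl
      apply hx; rw [hxa, snd_cc]
      rcases hκ with rfl | rfl
      · simp [tent]
      · norm_num [tent]
    rw [hxa, sec_cc _ _ _ h0 h1]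
    split_ifs with h
    · simp only [move]
      rw [dif_pos ⟨h0, h1⟩]
      split_ifs with hh
      · obtain ⟨u, hu⟩ := cons_of_head hh
        simp only [cmpE, hu, cmp, bar]
        simp [h]
      · simp [cmpE, cmp, h]
    · simp only [move]
      rw [dif_pos ⟨by linarith, by linarith⟩]
      split_ifs with hh
      · obtain ⟨u, hu⟩ := cons_of_head hh
        simp only [cmpE, hu, cmp, bar]
        simp [h]
      · simp [cmpE, cmp, h]

lemma cmp_continuousAt {κ : ℝ} (hκ : κ = 0 ∨ κ = 1 / 2) (e : E) (he : (proj e).1.2 ≠ κ) :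
    ContinuousAt (cmpE κ) e := by
  rw [proj_snd] at he
  suffices h : ∀ᶠ e' in 𝓝 e, cmpE κ e' = cmpE κ e by
    exact (continuousAt_const (y := cmpE κ e)).congr (h.mono fun _ h => h.symm)
  rcases e.le.lt_or_eq with h1 | h1
  · have hs := continuousAt_s h1
    have hs' : ContinuousAt (fun e : E => 1 - e.s) e := continuousAt_const.sub hs
    have hne : e.s ≠ κ := by
      intro h; apply he; rw [h]
      rcases hκ with rfl | rfl <;> norm_num [tent]
    have hne' : 1 - e.s ≠ κ := by
      intro h; apply he; rw [← tent_symm, h]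
      rcases hκ with rfl | rfl <;> norm_num [tent]
    have k1 : ∀ᶠ e' in 𝓝 e, (e'.s < κ ↔ e.s < κ) := by
      rcases lt_or_gt_of_ne hne with h | h
      · filter_upwards [hs.eventually (gt_mem_nhds h)] with e' h'
        exact ⟨fun _ => h, fun _ => h'⟩
      · filter_upwards [hs.eventually (lt_mem_nhds h)] with e' h'
        exact ⟨fun h => by linarith, fun h => by linarith⟩
    have k2 : ∀ᶠ e' in 𝓝 e, (1 - e'.s < κ ↔ 1 - e.s < κ) := by
      rcases lt_or_gt_of_ne hne' with h | h
      · filter_upwards [hs'.eventually (gt_mem_nhds h)] with e' h'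
        exact ⟨fun _ => h, fun _ => h'⟩
      · filter_upwards [hs'.eventually (lt_mem_nhds h)] with e' h'
        exact ⟨fun h => by linarith, fun h => by linarith⟩
    filter_upwards [eventually_edge h1, k1, k2] with e' hw h2 h3
    apply Subtype.ext
    simp only [cmpE, hw.1]
    unfold cmp
    split
    · rfl
    · simp only [h2, h3]
  · have hκ : κ = 1 / 2 := by
      rcases hκ with rfl | h
      · rw [h1] at he; simp [tent] at he
      · exact h
    subst hκ
    have hc : cmp (1 / 2) e.w e.s = e.w := by
      rw [h1]
      rcases e.w with _ | ⟨x, v⟩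
      · rfl
      · simp only [cmp]; norm_num
    filter_upwards [Metric.ball_mem_nhds e (one_half_pos (α := ℝ))] with e' he'
    rw [Metric.mem_ball, dist_comm] at he'
    apply Subtype.ext
    change cmp (1 / 2) e'.w e'.s = cmp (1 / 2) e.w e.s
    rw [hc]
    rcases near_vertex h1 (by linarith) with ⟨hw, hs⟩ | ⟨y, hw, hs⟩
    · rw [hw]
      rcases e.w with _ | ⟨x, v⟩
      · rfl
      · simp only [cmp]
        have a1 : ¬ e'.s < 1 / 2 := by linarith
        have a2 : 1 - e'.s < 1 / 2 := by linarith
        simp only [if_neg a1, if_pos a2]; split_ifs <;> rfl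
    · rw [hw]
      simp only [cmp]
      have a1 : e'.s < 1 / 2 := by linarith
      have a2 : ¬ 1 - e'.s < 1 / 2 := by linarith
      simp only [if_pos a1, if_neg a2]; split_ifs <;> rfl

lemma evenly {κ : ℝ} (hκ : κ = 0 ∨ κ = 1 / 2) (x : Xs) (hx : x.1.2 ≠ κ) :
    IsEvenlyCovered proj x Wd := by
  have hU : IsOpen {x : Xs | x.1.2 ≠ κ} :=
    isOpen_ne.preimage (continuous_snd.comp continuous_subtype_val)
  refine ⟨inferInstance, {x : Xs | x.1.2 ≠ κ}, hx, hU, hU.preimage continuous_proj,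
    { toFun := fun e => (⟨proj e.1, e.2⟩, cmpE κ e.1)
      invFun := fun q => ⟨sec κ q.2 q.1.1.1, by
        change (proj (sec κ q.2 q.1.1.1)).1.2 ≠ κ
        rw [proj_sec]; exact q.1.2⟩
      left_inv := fun e => Subtype.ext (sec_proj hκ e.1 e.2)
      right_inv := fun q => Prod.ext (Subtype.ext (proj_sec κ q.2 q.1.1))
        (cmp_sec hκ q.2 q.1.1 q.1.2)
      continuous_toFun := ?_
      continuous_invFun := ?_ }, fun e => rfl⟩
  · refine ((continuous_proj.comp continuous_subtype_val).subtype_mk _).prodMk ?_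
    rw [continuous_iff_continuousAt]
    exact fun e => (cmp_continuousAt hκ e.1 e.2).comp continuous_subtype_val.continuousAt
  · refine Continuous.subtype_mk ?_ _
    rw [continuous_prod_of_discrete_right]
    intro v
    rw [continuous_iff_continuousAt]
    exact fun q => ContinuousAt.comp (f := Subtype.val) (g := fun x : Xs => sec κ v x.1)
      (sec_continuousAt hκ v q.1 q.2) continuous_subtype_val.continuousAt

theorem cov : IsCoveringMap proj := by
  intro x
  suffices h : IsEvenlyCovered proj x Wd from h.to_isEvenlyCovered_preimage
  by_cases h : x.1.2 = 0
  · exact evenly (Or.inr rfl) x (by rw [h]; norm_num)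
  · exact evenly (Or.inl rfl) x h

end WH

namespace WH

section general
variable {Z : Type*} [TopologicalSpace Z]

lemma joined_of_homotopic {x y : Z} {p q : Path x y} (h : p.Homotopic q) : Joined p q := by
  obtain ⟨F⟩ := h
  refine ⟨⟨⟨fun t => F.eval t, ?_⟩, ?_, ?_⟩⟩
  · rw [← Path.continuous_uncurry_iff]
    exact F.continuous
  · ext s; simp
  · ext s; simp

lemma homotopic_of_joined {x y : Z} {p q : Path x y} (h : Joined p q) : p.Homotopic q := by
  obtain ⟨G⟩ := h
  have hc : Continuous fun q : I × I => G q.1 q.2 := by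
    rw [show (fun q : I × I => G q.1 q.2) = Function.uncurry fun t s => G t s from rfl]
    exact Path.continuous_uncurry_iff.2 G.continuous
  refine ⟨⟨⟨⟨fun q => G q.1 q.2, hc⟩, fun s => ?_, fun s => ?_⟩, fun t s hs => ?_⟩⟩
  · simp
  · simp
  · rcases hs with rfl | hs
    · simp
    · rw [Set.mem_singleton_iff] at hs; subst hs; simp

lemma piMk_eq {x : Z} {p q : Path x x} : piMk p = piMk q ↔ p.Homotopic q := by
  exact Quotient.eq.trans ⟨homotopic_of_joined, joined_of_homotopic⟩

end general

instance : ContractibleSpace E := by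
  rw [contractible_iff_id_nullhomotopic]
  refine ⟨rt, ⟨⟨contr, fun e => ?_, fun e => ?_⟩⟩⟩
  · exact contr_zero e
  · exact contr_one e

def PJ : C(E, Xs) := ⟨proj, continuous_proj⟩

lemma proj_rt : proj rt = pX := proj_vert ⟨[], trivial⟩

lemma proj_surj (x : Xs) : ∃ e, proj e = x := ⟨_, proj_sec 0 ⟨[], trivial⟩ x⟩

lemma lift_const (c : C(I, E)) (x : Xs) (h : ∀ t, proj (c t) = x) (t : I) : c t = c 0 := by
  exact cov.const_of_comp c.continuous (fun t t' => by simp only [Function.comp, h]) t 0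

/-- `X` is aspherical, cube version -/
lemma null_cube {n : ℕ} (hn : 2 ≤ n) (f : C(Fin n → I, Xs))
    (hf : ∀ y ∈ Cube.boundary (Fin n), f y = pX) :
    f.HomotopicRel (ContinuousMap.const _ pX) (Cube.boundary (Fin n)) := by
  let F : C(I × (Fin n → I), Xs) := f.comp ⟨fun q j => q.1 * q.2 j, by fun_prop⟩
  have i0 : Fin n := ⟨0, by omega⟩
  have hz : f 0 = pX := hf 0 ⟨i0, Or.inl rfl⟩
  have hF0 : ∀ a, F (0, a) = proj ((ContinuousMap.const _ rt : C(Fin n → I, E)) a) := by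
    intro a
    have : F (0, a) = f 0 := by
      change f _ = f _
      congr 1; ext j; simp
    rw [this, hz]; exact proj_rt.symm
  let G := cov.liftHomotopy F _ hF0
  have hG : ∀ q, proj (G q) = F q := fun q => congrFun (cov.liftHomotopy_lifts F _ hF0) q
  have hG0 : ∀ a, G (0, a) = rt := cov.liftHomotopy_zero F _ hF0
  let g : C(Fin n → I, E) := G.comp ⟨fun y => (1, y), by fun_prop⟩
  have hg : ∀ y, proj (g y) = f y := by
    intro y
    have : F (1, y) = f y := by
      change f _ = f _
      congr 1; ext j; simp
    rw [← this, ← hG]; rfl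
  have hgz : g 0 = rt := by
    have h := lift_const (G.comp ⟨fun t => (t, 0), by fun_prop⟩) pX (fun t => by
      change proj (G (t, 0)) = pX
      rw [hG, ← hz]
      change f _ = f _
      congr 1; ext j; simp) 1
    exact h.trans (hG0 0)
  have hb : ∀ y ∈ Cube.boundary (Fin n), g y = rt := by
    rintro y ⟨i, hi⟩
    obtain ⟨k, hk⟩ : ∃ k : Fin n, k ≠ i := by
      haveI : Nontrivial (Fin n) := Fin.nontrivial_iff_two_le.2 hn
      exact exists_ne i
    let y1 : Fin n → I := fun j => if j = i then y i else 0
    have e1 : g y = g y1 := by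
      have h := lift_const (g.comp ⟨fun t j => if j = i then y i else t * y j, by
        refine continuous_pi fun j => ?_
        split_ifs <;> fun_prop⟩) pX (fun t => by
        rw [ContinuousMap.comp_apply, hg]
        exact hf _ ⟨i, by simpa using hi⟩) 1
      have h1 : (fun j => if j = i then y i else 1 * y j) = y := by
        ext j; split_ifs with h
        · rw [h]
        · simp
      have h2 : (fun j => if j = i then y i else 0 * y j) = y1 := by
        ext j; simp [y1]
      have h' : g (fun j => if j = i then y i else 1 * y j) =
        g (fun j => if j = i then y i else 0 * y j) := h
      rwa [h1, h2] at h'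
    have e2 : g y1 = g 0 := by
      have h := lift_const (g.comp ⟨fun t j => t * y1 j, by fun_prop⟩) pX (fun t => by
        rw [ContinuousMap.comp_apply, hg]
        exact hf _ ⟨k, by simp [y1, hk]⟩) 1
      have h' : g (fun j => 1 * y1 j) = g (fun j => 0 * y1 j) := h
      have h1 : (fun j => 1 * y1 j) = y1 := by ext j; simp
      have h2 : (fun j => 0 * y1 j) = 0 := by ext j; simp
      rwa [h1, h2] at h'
    rw [e1, e2, hgz]
  refine ⟨⟨⟨PJ.comp (contr.comp ⟨fun q => (q.1, g q.2), by fun_prop⟩), fun y => ?_, fun y => ?_⟩,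
    fun t y hy => ?_⟩⟩
  · change proj (contr (0, g y)) = f y
    rw [contr_zero, hg]
  · change proj (contr (1, g y)) = pX
    rw [contr_one, proj_rt]
  · change proj (contr (t, g y)) = f y
    rw [hb y hy, contr_rt, proj_rt, hf y hy]

lemma pi_sub_of_null {Z : Type*} [TopologicalSpace Z] {z : Z} {n : ℕ}
    (h : ∀ f : C(Fin n → I, Z), (∀ y ∈ Cube.boundary (Fin n), f y = z) →
      f.HomotopicRel (ContinuousMap.const _ z) (Cube.boundary (Fin n))) :
    Subsingleton (HomotopyGroup.Pi n Z z) := by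
  have key : ∀ f : GenLoop (Fin n) Z z, GenLoop.Homotopic f GenLoop.const := fun f => h f.1 f.2
  refine ⟨fun a b => ?_⟩
  induction a using Quotient.inductionOn with | _ a => ?_
  induction b using Quotient.inductionOn with | _ b => ?_
  exact Quotient.sound ((key a).trans (key b).symm)

/-- nearby loops in `X` are homotopic -/
lemma near_homotopic {x : Xs} (γ₀ : Path x x) : ∀ᶠ γ in 𝓝 γ₀, Path.Homotopic γ γ₀ := by
  obtain ⟨e, he⟩ := proj_surj x
  let H : C(I × Path x x, Xs) := ⟨fun q => q.2 q.1, by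
    exact continuous_eval.comp continuous_swap⟩
  have hH0 : ∀ γ, H (0, γ) = proj ((ContinuousMap.const _ e : C(Path x x, E)) γ) := by
    intro γ
    change γ 0 = proj e
    rw [he]; exact γ.source
  let G := cov.liftHomotopy H _ hH0
  have hG : ∀ q, proj (G q) = H q := fun q => congrFun (cov.liftHomotopy_lifts H _ hH0) q
  have hG0 : ∀ a, G (0, a) = e := cov.liftHomotopy_zero H _ hH0
  let ep : Path x x → proj ⁻¹' {x} := fun γ => ⟨G (1, γ), by
    change proj (G (1, γ)) = x
    rw [hG]; exact γ.target⟩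
  have hep : Continuous ep := by
    refine Continuous.subtype_mk ?_ _
    exact G.continuous.comp (by fun_prop)
  haveI : DiscreteTopology (proj ⁻¹' {x}) := (cov x).discreteTopology_fiber
  have hopen : IsOpen (ep ⁻¹' {ep γ₀}) := (isOpen_discrete _).preimage hep
  filter_upwards [hopen.mem_nhds rfl] with γ hγ
  have h1 : G (1, γ) = G (1, γ₀) := congrArg Subtype.val hγ
  let Γ : ∀ γ : Path x x, C(I, E) := fun γ => G.comp ⟨fun t => (t, γ), by fun_prop⟩
  have hΓ : ∀ γ, PJ.comp (Γ γ) = γ.toContinuousMap := by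
    intro γ; ext1 t
    exact hG (t, γ)
  let p0 : Path e (G (1, γ₀)) := ⟨Γ γ₀, hG0 γ₀, rfl⟩
  let p1 : Path e (G (1, γ₀)) := ⟨Γ γ, hG0 γ, h1⟩
  have hh : p1.Homotopic p0 := SimplyConnectedSpace.paths_homotopic p1 p0
  obtain ⟨K⟩ := hh
  have K' : (PJ.comp (Γ γ)).HomotopicRel (PJ.comp (Γ γ₀)) {0, 1} := ⟨K.compContinuousMap PJ⟩
  rw [hΓ, hΓ] at K'
  exact K'

lemma piTop_discrete (x : Xs) : DiscreteTopology (piTop Xs x) := by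
  rw [discreteTopology_iff_forall_isOpen]
  intro s
  have hq : Topology.IsQuotientMap (piMk : Path x x → piTop Xs x) := isQuotientMap_quotient_mk'
  rw [← hq.isOpen_preimage, isOpen_iff_mem_nhds]
  intro γ hγ
  filter_upwards [near_homotopic γ] with γ' h
  change piMk γ' ∈ s
  rw [piMk_eq.2 h]; exact hγ

lemma cc_mem (n : ℕ) (s : I) : cc n s ∈ Xs := ⟨n, s, s.2.1, s.2.2, rfl⟩

/-- the `n`-th loop -/
def LL (n : ℕ) : Path pX pX where
  toFun s := ⟨cc n s, cc_mem n s⟩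
  continuous_toFun := by
    refine Continuous.subtype_mk ?_ _
    rw [continuous_iff_continuousAt]
    exact fun s => ContinuousAt.comp (f := fun s : I => (s : ℝ)) (g := cc n)
      (continuous_cc n s.2.1) continuous_subtype_val.continuousAt
  source' := Subtype.ext (by simpa using cc_zero n)
  target' := Subtype.ext (by simpa using cc_one n)

def lpt (n : ℕ) (s : I) : E :=
  if h : 0 < (s : ℝ) then ⟨[(n, true)], s, ⟨by simp, trivial⟩, h, s.2.2, by simp⟩ else rt

lemma phi_lpt (n : ℕ) (s : I) : phi (lpt n s).w (lpt n s).s = phi [(n, true)] s := by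
  unfold lpt
  split_ifs with h
  · rfl
  · have : (s : ℝ) = 0 := le_antisymm (not_lt.1 h) s.2.1
    rw [this]; simp [rt, vert, phi_zero]

lemma continuous_lpt (n : ℕ) : Continuous (lpt n) := by
  have : LipschitzWith 1 (lpt n) := by
    refine LipschitzWith.of_dist_le_mul fun s s' => ?_
    rw [NNReal.coe_one, one_mul]
    refine dist_le dist_nonneg fun v => ?_
    rw [phi_lpt, phi_lpt]
    exact phi_lip _ _ _ _
  exact this.continuous

lemma LL_not_null (n : ℕ) : ¬ (LL n).Homotopic (Path.refl pX) := by
  intro h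
  have hc : (LL n).toContinuousMap 0 = proj rt := by rw [proj_rt]; exact (LL n).source
  have hc' : (Path.refl pX).toContinuousMap 0 = proj rt := by rw [proj_rt]; rfl
  have h1 := cov.liftPath_apply_one_eq_of_homotopicRel h rt hc hc'
  have h2 := (cov.eq_liftPath_iff' hc (Γ := ⟨lpt n, continuous_lpt n⟩)).2 ⟨by
    ext1 s
    apply Subtype.ext
    change (proj (lpt n s)).1 = cc n s
    unfold lpt
    split_ifs with h
    · simp [proj, pr, arc]
    · have : (s : ℝ) = 0 := le_antisymm (not_lt.1 h) s.2.1
      rw [proj_rt, this, cc_zero], by simp [lpt]⟩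
  have h3 := (cov.eq_liftPath_iff' hc' (Γ := ContinuousMap.const _ rt)).2 ⟨by
    ext1 s; exact proj_rt, rfl⟩
  rw [← h2, ← h3] at h1
  have h4 : (lpt n 1).w = rt.w := congrArg E.w h1
  simp [lpt, rt, vert] at h4

end WH

namespace WH

def Al : Set (ℝ × ℝ) := {(0 : ℝ)} ×ˢ Set.Icc (0 : ℝ) (1 / 2)

def Ys : Set (ℝ × ℝ) := Xs ∪ Al

lemma hsub : Xs ⊆ Ys := Set.subset_union_left

def pY : Ys := ⟨(0, 0), hsub hp⟩

def J : C(Xs, Ys) := ⟨Set.inclusion hsub, continuous_inclusion hsub⟩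

lemma conn_X : IsPathConnected Xs := by
  rw [isPathConnected_iff_pathConnectedSpace]
  exact Function.Surjective.pathConnectedSpace (f := proj) proj_surj continuous_proj

lemma conn_Y : IsPathConnected Ys := by
  refine conn_X.union (Convex.isPathConnected ?_ ?_) ⟨(0, 0), hp, ?_⟩
  · exact (convex_singleton _).prod (convex_Icc _ _)
  · exact ⟨(0, 0), by simp [Al]⟩
  · simp [Al]

lemma tent_le_half (a : ℝ) : tent a ≤ 1 / 2 := by
  unfold tent
  rcases le_total a (1 / 2) with h | h
  · exact (min_le_left _ _).trans h
  · exact (min_le_right _ _).trans (by linarith)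

lemma Xs_bounds {q : ℝ × ℝ} (h : q ∈ Xs) : 0 ≤ q.1 ∧ q.1 ≤ q.2 ∧ q.2 ≤ 1 / 2 ∧
    (q.1 = 0 → q.2 = 0) := by
  obtain ⟨n, a, h0, h1, rfl⟩ := h
  have h := tent_nonneg h0 h1
  have h3 : (1:ℝ) ≤ n + 1 + a := by have : (0:ℝ) ≤ n := n.cast_nonneg; linarith
  refine ⟨by simp only [cc]; positivity, div_le_self h h3, tent_le_half a, fun h => ?_⟩
  simp only [cc] at h ⊢
  rcases div_eq_zero_iff.1 h with h | h
  · exact h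
  · linarith

lemma Ys_bounds (q : Ys) : 0 ≤ q.1.1 ∧ q.1.1 ≤ q.1.2 ∧ q.1.2 ≤ 1 / 2 := by
  rcases q.2 with h | h
  · have := Xs_bounds h
    exact ⟨this.1, this.2.1, this.2.2.1⟩
  · obtain ⟨h1, h2⟩ := h
    rw [Set.mem_singleton_iff] at h1
    rw [h1]
    exact ⟨le_rfl, h2.1, h2.2⟩

lemma Ys_mem (q : Ys) (h : q.1.1 ≠ 0) : q.1 ∈ Xs := by
  rcases q.2 with h' | h'
  · exact h'
  · exact absurd h'.1 h

lemma norm_Ys (q : Ys) : dist q pY = q.1.2 := by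
  obtain ⟨h1, h2, h3⟩ := Ys_bounds q
  rw [Subtype.dist_eq, Prod.dist_eq]
  simp only [pY, Real.dist_eq, sub_zero]
  rw [abs_of_nonneg h1, abs_of_nonneg (h1.trans h2), max_eq_right h2]

lemma Al_mem {y : ℝ} (h0 : 0 ≤ y) (h1 : y ≤ 1 / 2) : ((0 : ℝ), y) ∈ Ys := by
  right; exact ⟨rfl, h0, h1⟩

/-- squash the limit arc -/
def rr (t : I) (q : Ys) : Ys :=
  if q.1.1 = 0 then ⟨(0, (1 - t) * q.1.2), by
    obtain ⟨h1, h2, h3⟩ := Ys_bounds q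
    have ht0 := t.2.1
    have ht1 := t.2.2
    refine Al_mem (mul_nonneg (by linarith) (h1.trans h2)) ?_
    nlinarith⟩
  else q

lemma rr_zero (q : Ys) : rr 0 q = q := by
  unfold rr
  split_ifs with h
  · apply Subtype.ext
    ext <;> simp [h]
  · rfl

lemma rr_fix (t : I) (q : Ys) (h : q.1 ∈ Xs) : rr t q = q := by
  unfold rr
  split_ifs with h'
  · apply Subtype.ext
    have := (Xs_bounds h).2.2.2 h'
    ext <;> simp [this, h']
  · rfl

lemma rr_one (q : Ys) : (rr 1 q).1 ∈ Xs := by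
  unfold rr
  split_ifs with h
  · simpa using hp
  · exact Ys_mem q h

lemma rr_snd_le (t : I) (q : Ys) : (rr t q).1.2 ≤ q.1.2 := by
  unfold rr
  split_ifs with h
  · obtain ⟨h1, h2, h3⟩ := Ys_bounds q
    have ht0 := t.2.1
    simp only
    nlinarith
  · exact le_rfl

lemma squash_local {K : Type*} [TopologicalSpace K] [LocallyConnectedSpace K] (f : C(K, Ys))
    (k₀ : K) (h0 : (f k₀).1.1 = 0) (hpos : 0 < (f k₀).1.2) :
    ∀ᶠ k in 𝓝 k₀, (f k).1.1 = 0 := by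
  have hsnd : Continuous fun k => (f k).1.2 := by fun_prop
  have hU : {k | 0 < (f k).1.2} ∈ 𝓝 k₀ := (isOpen_lt continuous_const hsnd).mem_nhds hpos
  obtain ⟨V, hVU, hVo, hkV, hVc⟩ :=
    locallyConnectedSpace_iff_subsets_isOpen_isConnected.1 ‹_› k₀ _ hU
  filter_upwards [hVo.mem_nhds hkV] with k hk
  by_contra hne
  have hkpos : 0 < (f k).1.1 := lt_of_le_of_ne (Ys_bounds _).1 (Ne.symm hne)
  have hθ : ContinuousOn (fun k => (f k).1.1 / (f k).1.2) V := by
    refine ContinuousOn.div (by fun_prop) hsnd.continuousOn fun k hk => (hVU hk).ne'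
  have hiv := hVc.isPreconnected.intermediate_value hkV hk hθ
  have hp1 : 0 < (f k).1.1 / (f k).1.2 := div_pos hkpos (hVU hk)
  obtain ⟨m, hm⟩ := exists_nat_one_div_lt hp1
  obtain ⟨k', hk', he⟩ := hiv (show 1 / ((m : ℝ) + 1) ∈ _ from
    ⟨by simp only [h0, zero_div]; positivity, hm.le⟩)
  simp only at he
  have hk1 : (f k').1.1 ≠ 0 := by
    intro h
    rw [h, zero_div] at he
    have : 0 < 1 / ((m : ℝ) + 1) := by positivity
    linarith
  rcases Xs_cases ⟨_, Ys_mem _ hk1⟩ with h | ⟨n, a, ha0, ha1, h⟩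
  · exact hk1 (congrArg (fun x : Xs => x.1.1) h)
  · simp only at h
    have hs := cc_slope n ha0 ha1
    rw [← h] at hs
    have he' : (f k').1.2 / (f k').1.1 = m + 1 := by
      rw [← inv_div, he]; simp
    rw [he'] at hs
    have h1 : (n : ℝ) < m := by linarith
    have h2 : (m : ℝ) < n + 1 := by linarith
    have h1' : n < m := by exact_mod_cast h1
    have h2' : m < n + 1 := by exact_mod_cast h2
    omega

lemma squash_cont {K : Type*} [TopologicalSpace K] [LocallyConnectedSpace K] (f : C(K, Ys)) :
    Continuous fun q : I × K => rr q.1 (f q.2) := by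
  rw [continuous_iff_continuousAt]
  rintro ⟨t₀, k₀⟩
  by_cases h0 : (f k₀).1.1 = 0
  · rcases (Ys_bounds (f k₀)).1.trans (Ys_bounds (f k₀)).2.1 |>.eq_or_lt with hz | hpos
    · have hfk : f k₀ = pY := Subtype.ext (Prod.ext h0 hz.symm)
      have hr : rr t₀ (f k₀) = pY := by rw [hfk]; exact rr_fix _ _ hp
      rw [Metric.continuousAt_iff']
      intro ε hε
      have h1 : ContinuousAt (fun q : I × K => f q.2) (t₀, k₀) := by fun_prop
      filter_upwards [Metric.continuousAt_iff'.1 h1 ε hε] with q hq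
      simp only [hfk] at hq
      simp only [hr]
      rw [norm_Ys] at hq ⊢
      exact (rr_snd_le _ _).trans_lt hq
    · rw [Topology.IsEmbedding.subtypeVal.continuousAt_iff]
      have h1 : ContinuousAt (fun q : I × K => ((0 : ℝ), (1 - (q.1 : ℝ)) * (f q.2).1.2))
          (t₀, k₀) := by fun_prop
      refine h1.congr ?_
      have h2 := (squash_local f k₀ h0 hpos)
      have h3 : ∀ᶠ q : I × K in 𝓝 (t₀, k₀), (f q.2).1.1 = 0 :=
        (continuous_snd.tendsto (t₀, k₀)).eventually h2
      filter_upwards [h3] with q hq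
      simp [rr, hq]
  · have h1 : ContinuousAt (fun q : I × K => f q.2) (t₀, k₀) := by fun_prop
    refine h1.congr ?_
    have h2 : ContinuousAt (fun q : I × K => (f q.2).1.1) (t₀, k₀) := by fun_prop
    filter_upwards [h2.eventually_ne h0] with q hq
    simp [rr, hq]

/-- pushing maps from locally connected spaces into `X` -/
lemma push {K : Type*} [TopologicalSpace K] [LocallyConnectedSpace K] (f : C(K, Ys)) :
    ∃ (g : C(K, Xs)) (H : C(I × K, Ys)), (∀ k, H (0, k) = f k) ∧ (∀ k, H (1, k) = J (g k)) ∧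
      ∀ k, (f k).1 ∈ Xs → (∀ t, H (t, k) = f k) ∧ (g k).1 = (f k).1 := by
  refine ⟨⟨fun k => ⟨(rr 1 (f k)).1, rr_one _⟩, ?_⟩, ⟨_, squash_cont f⟩,
    fun k => rr_zero _, fun k => rfl, fun k hk => ⟨fun t => rr_fix _ _ hk, ?_⟩⟩
  · refine Continuous.subtype_mk ?_ _
    exact continuous_subtype_val.comp ((squash_cont f).comp (Continuous.prodMk_right 1))
  · change (rr 1 (f k)).1 = _
    rw [rr_fix _ _ hk]

instance lpcCube {n : ℕ} : LocallyPathConnectedSpace (Fin n → I) := by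
  have h : Topology.IsQuotientMap
      (fun (y : Fin n → ℝ) (i : Fin n) => Set.projIcc (0 : ℝ) 1 zero_le_one (y i)) :=
    Topology.IsQuotientMap.of_inverse (f := fun (y : Fin n → I) (i : Fin n) => (y i : ℝ))
      (by fun_prop) (continuous_pi fun i => continuous_projIcc.comp (continuous_apply i))
      (fun y => by ext i; simp)
  exact h.locallyPathConnectedSpace

instance lpcI : LocallyPathConnectedSpace I := by
  have h : Topology.IsQuotientMap (Set.projIcc (0 : ℝ) 1 zero_le_one) :=
    Topology.IsQuotientMap.of_inverse (f := fun y : I => (y : ℝ))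
      (by fun_prop) continuous_projIcc
      (fun y => by simp)
  exact h.locallyPathConnectedSpace

lemma null_cube_Y {n : ℕ} (hn : 2 ≤ n) (f : C(Fin n → I, Ys))
    (hf : ∀ y ∈ Cube.boundary (Fin n), f y = pY) :
    f.HomotopicRel (ContinuousMap.const _ pY) (Cube.boundary (Fin n)) := by
  obtain ⟨g, H, h0, h1, h2⟩ := push f
  have hX : ∀ y ∈ Cube.boundary (Fin n), (f y).1 ∈ Xs := fun y hy => by
    rw [hf y hy]; exact hp
  have e1 : f.HomotopicRel (J.comp g) (Cube.boundary (Fin n)) :=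
    ⟨⟨⟨H, h0, h1⟩, fun t y hy => (h2 y (hX y hy)).1 t⟩⟩
  have hg : ∀ y ∈ Cube.boundary (Fin n), g y = pX := fun y hy => by
    apply Subtype.ext
    rw [(h2 y (hX y hy)).2, hf y hy]; rfl
  obtain ⟨K⟩ := null_cube hn g hg
  exact e1.trans ⟨K.compContinuousMap J⟩

lemma inj_J {γ γ' : Path pX pX} (h : (γ.map J.continuous).Homotopic (γ'.map J.continuous)) :
    γ.Homotopic γ' := by
  obtain ⟨F⟩ := h
  obtain ⟨g, _, _, _, h2⟩ := push F.toContinuousMap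
  have hF0 : ∀ s, F.toContinuousMap (0, s) = J (γ s) := fun s => F.apply_zero s
  have hF1 : ∀ s, F.toContinuousMap (1, s) = J (γ' s) := fun s => F.apply_one s
  refine ⟨⟨⟨g, fun s => ?_, fun s => ?_⟩, fun t s hs => ?_⟩⟩
  · apply Subtype.ext
    change (g (0, s)).1 = (γ s).1
    rw [(h2 (0, s) (by rw [hF0]; exact (γ s).2)).2, hF0]; rfl
  · apply Subtype.ext
    change (g (1, s)).1 = (γ' s).1
    rw [(h2 (1, s) (by rw [hF1]; exact (γ' s).2)).2, hF1]; rfl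
  · apply Subtype.ext
    change (g (t, s)).1 = (γ s).1
    have h : F.toContinuousMap (t, s) = J (γ s) := F.prop' t s hs
    rw [(h2 (t, s) (by rw [h]; exact (γ s).2)).2, h]; rfl

lemma surj_J (γ : Path pY pY) : ∃ γ' : Path pX pX, Path.Homotopic (γ'.map J.continuous) γ := by
  obtain ⟨g, H, h0, h1, h2⟩ := push γ.toContinuousMap
  have hX : ∀ s ∈ ({0, 1} : Set I), (γ s).1 = (0, 0) := by
    rintro s (rfl | hs)
    · rw [γ.source]; rfl
    · rw [Set.mem_singleton_iff] at hs; rw [hs, γ.target]; rfl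
  have hX' : ∀ s ∈ ({0, 1} : Set I), (γ s).1 ∈ Xs := fun s hs => by rw [hX s hs]; exact hp
  have hg : ∀ s ∈ ({0, 1} : Set I), g s = pX := fun s hs =>
    Subtype.ext ((h2 s (hX' s hs)).2.trans (hX s hs))
  refine ⟨⟨g, hg 0 (by simp), hg 1 (by simp)⟩, Path.Homotopic.symm ⟨⟨⟨H, h0, h1⟩, fun t s hs => ?_⟩⟩⟩
  exact (h2 s (hX' s hs)).1 t

lemma bij_J : Function.Bijective (piMap (continuous_inclusion hsub) pX) := by
  constructor
  · intro a b
    induction a using Quotient.inductionOn with | _ a => ?_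
    induction b using Quotient.inductionOn with | _ b => ?_
    intro h
    exact piMk_eq.2 (inj_J (piMk_eq.1 h))
  · intro b
    induction b using Quotient.inductionOn with | _ b => ?_
    obtain ⟨γ, hγ⟩ := surj_J b
    exact ⟨piMk γ, piMk_eq.2 hγ⟩

def AL : Path pY pY where
  toFun s := ⟨(0, tent s), Al_mem (tent_nonneg s.2.1 s.2.2) (tent_le_half _)⟩
  continuous_toFun := by
    refine Continuous.subtype_mk ?_ _
    exact continuous_const.prodMk (continuous_tent.comp continuous_subtype_val)
  source' := Subtype.ext (by simp [tent, pY])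
  target' := Subtype.ext (by simp [tent, pY])

lemma AL_null : AL.Homotopic (Path.refl pY) := by
  have hc : Continuous fun q : I × I => rr q.1 (AL q.2) := squash_cont AL.toContinuousMap
  refine ⟨⟨⟨⟨_, hc⟩, fun s => rr_zero _, fun s => ?_⟩, fun t s hs => ?_⟩⟩
  · apply Subtype.ext
    change (rr 1 (AL s)).1 = (0, 0)
    have : (AL s).1.1 = 0 := rfl
    unfold rr
    rw [if_pos this]; simp
  · apply rr_fix
    rcases hs with rfl | hs
    · rw [AL.source]; exact hp
    · rw [Set.mem_singleton_iff] at hs; rw [hs, AL.target]; exact hp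

def LY (n : ℕ) : Path pY pY := (LL n).map J.continuous

lemma LY_not_AL (n : ℕ) : ¬ (LY n).Homotopic AL := by
  intro h
  have h1 : (LY n).Homotopic ((Path.refl pX).map J.continuous) := h.trans AL_null
  exact LL_not_null n (inj_J h1)

lemma LY_tendsto : Filter.Tendsto LY Filter.atTop (𝓝 AL) := by
  rw [nhds_induced, Filter.tendsto_comap_iff, ContinuousMap.tendsto_iff_tendstoUniformly,
    Metric.tendstoUniformly_iff]
  intro ε hε
  obtain ⟨N, hN⟩ := exists_nat_one_div_lt hε
  filter_upwards [Filter.eventually_ge_atTop N] with n hn s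
  rw [dist_comm]
  change dist (cc n s) (0, tent s) < ε
  refine lt_of_le_of_lt ?_ hN
  have h0 := s.2.1
  have ht := tent_nonneg s.2.1 s.2.2
  have ht' := tent_le_half s
  have hn' : (N : ℝ) ≤ n := by exact_mod_cast hn
  rw [Prod.dist_eq]
  simp only [cc, dist_self, Real.dist_eq, sub_zero]
  have hN0 : (0:ℝ) ≤ N := N.cast_nonneg
  refine max_le ?_ (by positivity)
  rw [abs_of_nonneg (div_nonneg ht (by linarith))]
  exact div_le_div₀ zero_le_one (by linarith) (by linarith) (by linarith)

lemma no_homeo : IsEmpty (piTop Xs pX ≃ₜ piTop Ys pY) := by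
  refine ⟨fun h => ?_⟩
  have hd : DiscreteTopology (piTop Xs pX) := piTop_discrete pX
  have hd' : DiscreteTopology (piTop Ys pY) := h.symm.isEmbedding.discreteTopology
  have hc : Continuous (piMk : Path pY pY → piTop Ys pY) := continuous_quotient_mk'
  have ho : IsOpen (piMk ⁻¹' {piMk AL} : Set (Path pY pY)) := (isOpen_discrete _).preimage hc
  obtain ⟨n, hn⟩ := (LY_tendsto.eventually (ho.mem_nhds rfl)).exists
  exact LY_not_AL n (piMk_eq.1 hn)

lemma cancel_left {Z : Type*} [TopologicalSpace Z] {x y z : Z} (c : Path x y) {p q : Path y z}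
    (h : (c.trans p).Homotopic (c.trans q)) : p.Homotopic q := by
  have key : ∀ p : Path y z, p.Homotopic (c.symm.trans (c.trans p)) := by
    intro p
    have h1 : ((Path.refl y).trans p).Homotopic p := ⟨Path.Homotopy.reflTrans p⟩
    have h2 : (Path.refl y).Homotopic (c.symm.trans c) := ⟨Path.Homotopy.reflSymmTrans c⟩
    have h3 : ((c.symm.trans c).trans p).Homotopic (c.symm.trans (c.trans p)) :=
      ⟨Path.Homotopy.transAssoc _ _ _⟩
    exact h1.symm.trans ((h2.hcomp (.refl p)).trans h3)
  exact (key p).trans (((Path.Homotopic.refl c.symm).hcomp h).trans (key q).symm)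

lemma no_equiv : IsEmpty (ContinuousMap.HomotopyEquiv Xs Ys) := by
  refine ⟨fun φ => ?_⟩
  let f := φ.invFun
  let g := φ.toFun
  have ht : Filter.Tendsto (fun n => (LY n).map f.continuous) Filter.atTop
      (𝓝 (AL.map f.continuous)) :=
    ((continuous_pathMap f.continuous).tendsto AL).comp LY_tendsto
  obtain ⟨n, hn⟩ := (ht.eventually (near_homotopic _)).exists
  obtain ⟨F⟩ := φ.right_inv
  have e1 := Path.Homotopic.map_trans_evalAt F (LY n)
  have e2 := Path.Homotopic.map_trans_evalAt F AL
  have e3 : ((LY n).map (map_continuous (g.comp f))).Homotopic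
      (AL.map (map_continuous (g.comp f))) := hn.map g
  have e4 := e1.symm.trans ((e3.hcomp (.refl (F.evalAt pY))).trans e2)
  have e5 := cancel_left _ e4
  exact LY_not_AL n e5

end WH

/-- there exist path connected, aspherical, separable metric spaces
`X ⊆ Y` (subspaces of `ℝ²`) such that the inclusion induces an isomorphism on all
homotopy groups (it is bijective on `π₁` and all higher homotopy groups vanish),
yet the topological fundamental groups are not homeomorphic; in particular `X`
and `Y` do not have the same homotopy type. -/
theorem exists_whitehead_counterexample :
    ∃ (Xs Ys : Set (ℝ × ℝ)) (hsub : Xs ⊆ Ys) (p : ℝ × ℝ) (hp : p ∈ Xs),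
      IsPathConnected Xs ∧ IsPathConnected Ys ∧
      TopologicalSpace.SeparableSpace ↥Xs ∧ TopologicalSpace.SeparableSpace ↥Ys ∧
      (∀ n : ℕ, 2 ≤ n → Subsingleton (HomotopyGroup.Pi n ↥Xs ⟨p, hp⟩)) ∧
      (∀ n : ℕ, 2 ≤ n → Subsingleton (HomotopyGroup.Pi n ↥Ys ⟨p, hsub hp⟩)) ∧
      Function.Bijective
        (piMap (continuous_inclusion hsub) (⟨p, hp⟩ : ↥Xs)) ∧
      IsEmpty
        (piTop ↥Xs ⟨p, hp⟩ ≃ₜ piTop ↥Ys (Set.inclusion hsub ⟨p, hp⟩)) ∧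
      IsEmpty (ContinuousMap.HomotopyEquiv ↥Xs ↥Ys) := by
  exact ⟨WH.Xs, WH.Ys, WH.hsub, (0, 0), WH.hp, WH.conn_X, WH.conn_Y, inferInstance, inferInstance,
    fun n hn => WH.pi_sub_of_null fun f hf => WH.null_cube hn f hf,
    fun n hn => WH.pi_sub_of_null fun f hf => WH.null_cube_Y hn f hf,
    WH.bij_J, WH.no_homeo, WH.no_equiv⟩
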